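/- (Properties of the square-loss confidence sets in APE; Lemma 'concentrate-Q'.) In the setting of K adaptively collected episodes described below, assume Π-completeness: for all h ∈ [H], f_{h+1} ∈ F_{i,h+1} and π_i ∈ Π_i, the function T^{π_i×π_{-i}}_{i,h} f_{h+1} belongs to F_{i,h}. Define for each k the datasets D_h^k := { (s_h^t, a_{i,h}^t, r_{i,h}^t, s_{h+1}^t) : 1 ≤ t ≤ k−1 }, the losses L_h^{D}(f_h, f_{h+1}, π_i) := Σ_{(s,a,r,s')∈D} ( f_h(s,a) − r − f_{h+1}(s', π_{i,h+1}(s')) )², and the confidence sets B^1 := F_i × Π_i and B^{k+1} := { (f, π_i) ∈ B^k : L_h^{D_h^{k+1}}(f_h, f_{h+1}, π_i) ≤ min_{f'_h ∈ F_{i,h}} L_h^{D_h^{k+1}}(f'_h, f_{h+1}, π_i) + β for all h ∈ [H] }. Then there exist universal constants c, C > 0 such that, choosing β = c H² log( |Π_i| |F_i| K H / δ ), with probability at least 1−δ: (a) ( Q_i^{π_i×π_{-i}}, π_i ) ∈ B^k for all π_i ∈ Π_i and k ∈ [K]; (b) for all (k, h) ∈ [K]×[H] and all (f, π_i) ∈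 B^k: Σ_{t=1}^{k−1} [ ( f_h − T^{π_i×π_{-i}}_{i,h} f_{h+1} )(s_h^t, a_{i,h}^t) ]² ≤ C β; (c) for all (k, h) ∈ [K]×[H] and all (f, π_i) ∈ B^k: Σ_{t=1}^{k−1} E_{(s_h, a_{i,h}) ∼ π_i^t × π_{-i}}[ ( f_h − T^{π_i×π_{-i}}_{i,h} f_{h+1} )(s_h, a_{i,h})² ] ≤ C β, where the expectation is over the state–action distribution at step h of a fresh episode of π_i^t × π_{-i}. -/

import Mathlib

open MeasureTheory Finset

/-- A probability vector on a finite type. -/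
def IsDist {α : Type*} [Fintype α] (p : α → ℝ) : Prop :=
  (∀ a, 0 ≤ p a) ∧ ∑ a, p a = 1

/-- Combine player `i`'s action with a profile of actions of the other players into a
joint action. -/
def combine {m : ℕ} {A : Fin m → Type*} (i : Fin m) (ai : A i)
    (an : ∀ j : {j : Fin m // j ≠ i}, A j.1) (j : Fin m) : A j :=
  if h : j = i then cast (congrArg A h).symm ai else an ⟨j, h⟩

/-- Restrict a joint action to the players other than `i`. -/
def restrict {m : ℕ} {A : Fin m → Type*} (i : Fin m) (a : ∀ j, A j)
    (j : {j : Fin m // j ≠ i}) : A j.1 :=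
  a j.1

/-- Player `i`'s marginal Bellman operator at step `h`, with the other players playing
`πneg` and player `i` playing `polNext` at step `h + 1`. -/
noncomputable def bell {S : Type*} [Fintype S] {m : ℕ} {A : Fin m → Type*}
    [∀ j, Fintype (A j)] (i : Fin m) (P : ℕ → S → (∀ j, A j) → S → ℝ)
    (rew : ℕ → S → (∀ j, A j) → ℝ)
    (πneg : ℕ → S → (∀ j : {j : Fin m // j ≠ i}, A j.1) → ℝ)
    (polNext : S → A i) (h : ℕ) (f : S → A i → ℝ) (s : S) (b : A i) : ℝ :=
  ∑ an, πneg h s an *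
    (rew h s (combine i b an) + ∑ s', P h s (combine i b an) s' * f s' (polNext s'))

/-- Player `i`'s marginal Q-function `Q_{i,h}^{π_i × π_{-i}}` of the deterministic
Markov policy `p` against the opponents' policy `πneg` (zero-based steps). -/
noncomputable def Qfun {S : Type*} [Fintype S] {m : ℕ} {A : Fin m → Type*}
    [∀ j, Fintype (A j)] (i : Fin m) (Hh : ℕ) (P : ℕ → S → (∀ j, A j) → S → ℝ)
    (rew : ℕ → S → (∀ j, A j) → ℝ)
    (πneg : ℕ → S → (∀ j : {j : Fin m // j ≠ i}, A j.1) → ℝ)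
    {Pc : Type*} (pol : Pc → ℕ → S → A i) (p : Pc) : ℕ → S → A i → ℝ
  | h => fun s b =>
      if _hh : h < Hh then
        bell i P rew πneg (pol p (h + 1)) h (Qfun i Hh P rew πneg pol p (h + 1)) s b
      else 0
  termination_by h => Hh - h
  decreasing_by omega

/-- The state-occupancy measure at step `h` of the episode in which player `i` plays
the deterministic Markov policy `p` and the others play `πneg`, starting from `s1`. -/
noncomputable def occ {S : Type*} [Fintype S] [DecidableEq S] {m : ℕ}
    {A : Fin m → Type*} [∀ j, Fintype (A j)] (i : Fin m)
    (P : ℕ → S → (∀ j, A j) → S → ℝ)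
    (πneg : ℕ → S → (∀ j : {j : Fin m // j ≠ i}, A j.1) → ℝ)
    {Pc : Type*} (pol : Pc → ℕ → S → A i) (s1 : S) (p : Pc) : ℕ → S → ℝ
  | 0, s => if s = s1 then 1 else 0
  | (h + 1), s' => ∑ s, occ i P πneg pol s1 p h s *
      ∑ an, πneg h s an * P h s (combine i (pol p h s) an) s'

/-- The empirical square loss `L_h^{D_h^{k+1}}(f_h, f_{h+1}, π_i)` computed on the
first `k` episodes: `fh` plays the role of `f_h` and `fn : S → ℝ` the role of
`s' ↦ f_{h+1}(s', π_{i,h+1}(s'))`. -/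
noncomputable def lossFn {S : Type*} {m : ℕ} {A : Fin m → Type*} (i : Fin m)
    {Ω : Type*} (rew : ℕ → S → (∀ j, A j) → ℝ)
    (st : ℕ → ℕ → Ω → S) (aJ : ℕ → ℕ → Ω → ∀ j, A j)
    (k h : ℕ) (fh : S → A i → ℝ) (fn : S → ℝ) (ω : Ω) : ℝ :=
  ∑ t ∈ Finset.range k,
    (fh (st t h ω) (aJ t h ω i) - rew h (st t h ω) (aJ t h ω) - fn (st t (h + 1) ω)) ^ 2

/-- The square-loss confidence sets of APE: `Bset … k ω` is the confidence set
`B^{k+1}` built from the first `k` episodes (`Bset … 0 ω = B^1 = Fc × Pc`). -/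
noncomputable def Bset {S : Type*} [Fintype S] {m : ℕ} {A : Fin m → Type*}
    [∀ j, Fintype (A j)] (i : Fin m) {Ω : Type*} (Hh : ℕ)
    (rew : ℕ → S → (∀ j, A j) → ℝ)
    (st : ℕ → ℕ → Ω → S) (aJ : ℕ → ℕ → Ω → ∀ j, A j)
    (Pc Fc : Type*) [Fintype Fc] [Nonempty Fc]
    (pol : Pc → ℕ → S → A i) (fc : Fc → ℕ → S → A i → ℝ) (β : ℝ) :
    ℕ → Ω → Set (Fc × Pc)
  | 0, _ => Set.univ
  | (k + 1), ω =>
      Bset i Hh rew st aJ Pc Fc pol fc β k ω ∩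
        {gp | ∀ h < Hh,
          lossFn i rew st aJ (k + 1) h (fc gp.1 h)
              (fun s' => fc gp.1 (h + 1) s' (pol gp.2 (h + 1) s')) ω
            ≤ (⨅ g' : Fc, lossFn i rew st aJ (k + 1) h (fc g' h)
                  (fun s' => fc gp.1 (h + 1) s' (pol gp.2 (h + 1) s')) ω) + β}

section FiniteValued

variable {Ω α β : Type*}

/-- All level sets of `X` are measurable for `m`. -/
def LevelMeasurable (m : MeasurableSpace Ω) (X : Ω → α) : Prop :=
  ∀ x, MeasurableSet[m] {ω | X ω = x}

theorem LevelMeasurable.mono {m m' : MeasurableSpace Ω} {X : Ω → α}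
    (h : LevelMeasurable m X) (hm : m ≤ m') : LevelMeasurable m' X :=
  fun x => hm _ (h x)

theorem LevelMeasurable.prodMk {m : MeasurableSpace Ω} {X : Ω → α} {Y : Ω → β}
    (hX : LevelMeasurable m X) (hY : LevelMeasurable m Y) :
    LevelMeasurable m (fun ω => (X ω, Y ω)) := by
  intro x
  have : {ω | (X ω, Y ω) = x} = {ω | X ω = x.1} ∩ {ω | Y ω = x.2} := by
    ext ω
    simp [Prod.ext_iff]
  rw [this]
  exact MeasurableSet.inter (hX _) (hY _)

theorem LevelMeasurable.measurable_comp [Finite α] {m : MeasurableSpace Ω} {X : Ω → α}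
    (hX : LevelMeasurable m X) (φ : α → ℝ) : Measurable[m] (fun ω => φ (X ω)) := by
  intro B _
  have : (fun ω => φ (X ω)) ⁻¹' B = ⋃ x ∈ φ ⁻¹' B, {ω | X ω = x} := by
    ext ω
    simp
  rw [this]
  exact MeasurableSet.biUnion (Set.to_countable _) fun x _ => hX x

theorem exists_abs_le_of_finite [Finite α] (φ : α → ℝ) : ∃ C, ∀ a, |φ a| ≤ C :=
  Finite.exists_le fun a => |φ a|

theorem integrable_of_abs_le {m m0 : MeasurableSpace Ω} (hm : m ≤ m0) {μ : Measure Ω}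
    [IsFiniteMeasure μ] {W : Ω → ℝ} (hW : Measurable[m] W) (hWb : ∃ C, ∀ ω, |W ω| ≤ C) :
    Integrable W μ := by
  obtain ⟨C, hC⟩ := hWb
  exact Integrable.of_bound (hW.mono hm le_rfl).aestronglyMeasurable C
    (Filter.Eventually.of_forall hC)

theorem exists_abs_mul_comp_le [Finite α] {W : Ω → ℝ} (hW : ∃ C, ∀ ω, |W ω| ≤ C) (Y : Ω → α)
    (φ : α → ℝ) : ∃ C, ∀ ω, |W ω * φ (Y ω)| ≤ C := by
  obtain ⟨C, hC⟩ := hW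
  obtain ⟨D, hD⟩ := exists_abs_le_of_finite φ
  refine ⟨C * D, fun ω => ?_⟩
  rw [abs_mul]
  exact mul_le_mul (hC ω) (hD _) (abs_nonneg _) ((abs_nonneg _).trans (hC ω))

/-- A random function evaluated at a finite-valued random variable has the same integral as
its average under the conditional law of that variable. -/
theorem integral_eq_of_condExp_indicator [Fintype α] {m m0 : MeasurableSpace Ω} (hm : m ≤ m0)
    (μ : Measure Ω) [IsFiniteMeasure μ] {X : Ω → α} (hX : LevelMeasurable m0 X)
    {p : α → Ω → ℝ}
    (hp : ∀ x, μ[Set.indicator {ω | X ω = x} (fun _ => (1 : ℝ)) | m] =ᵐ[μ] p x)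
    {F : α → Ω → ℝ} (hF : ∀ x, Measurable[m] (F x)) (hb : ∀ x, ∃ C, ∀ ω, |F x ω| ≤ C) :
    ∫ ω, F (X ω) ω ∂μ = ∫ ω, ∑ x, F x ω * p x ω ∂μ := by
  classical
  have hind : ∀ x, Integrable (Set.indicator {ω | X ω = x} (fun _ => (1 : ℝ))) μ := fun x =>
    (integrable_const (1 : ℝ)).indicator (hX x)
  have hFm : ∀ x, AEStronglyMeasurable (F x) μ := fun x =>
    ((hF x).mono hm le_rfl).aestronglyMeasurable
  have hprod : ∀ x, Integrable
      (F x * Set.indicator {ω | X ω = x} (fun _ => (1 : ℝ))) μ := by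
    intro x
    obtain ⟨C, hC⟩ := hb x
    exact (hind x).bdd_mul (hFm x) (Filter.Eventually.of_forall hC)
  have hpint : ∀ x, Integrable (fun ω => F x ω * p x ω) μ := by
    intro x
    obtain ⟨C, hC⟩ := hb x
    exact ((integrable_condExp (m := m)).congr (hp x)).bdd_mul (hFm x)
      (Filter.Eventually.of_forall hC)
  have hsum : ∀ ω, F (X ω) ω =
      ∑ x, (F x * Set.indicator {ω | X ω = x} (fun _ => (1 : ℝ))) ω := by
    intro ω
    simp [Set.indicator_apply]
  simp_rw [hsum]
  rw [integral_finsetSum _ fun x _ => hprod x, integral_finsetSum _ fun x _ => hpint x]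
  refine Finset.sum_congr rfl fun x _ => ?_
  rw [← integral_condExp hm]
  refine integral_congr_ae ?_
  filter_upwards [condExp_mul_of_stronglyMeasurable_left (hF x).stronglyMeasurable (hprod x)
    (hind x), hp x] with ω h1 h2
  rw [h1, Pi.mul_apply, h2]

end FiniteValued

section ExponentialSupermartingale

variable {Ω α : Type*}

theorem integral_exp_sum_le_one [Finite α] {m0 : MeasurableSpace Ω} (μ : Measure Ω)
    [IsProbabilityMeasure μ] {𝓕 : ℕ → MeasurableSpace Ω} (h𝓕 : ∀ t, 𝓕 t ≤ m0)
    (hmono : ∀ t, 𝓕 t ≤ 𝓕 (t + 1)) {X : ℕ → Ω → α}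
    (hX : ∀ t, LevelMeasurable (𝓕 (t + 1)) (X t)) (φ : α → ℝ) (K : ℕ)
    (hstep : ∀ t < K, ∀ W : Ω → ℝ, Measurable[𝓕 t] W → (∃ C, ∀ ω, |W ω| ≤ C) →
      (∀ ω, 0 ≤ W ω) → ∫ ω, W ω * Real.exp (φ (X t ω)) ∂μ ≤ ∫ ω, W ω ∂μ) :
    ∀ k ≤ K, Integrable (fun ω => Real.exp (∑ t ∈ Finset.range k, φ (X t ω))) μ ∧
      ∫ ω, Real.exp (∑ t ∈ Finset.range k, φ (X t ω)) ∂μ ≤ 1 := by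
  obtain ⟨B, hB⟩ := exists_abs_le_of_finite φ
  have hmeas : ∀ k, Measurable[𝓕 k] (fun ω => ∑ t ∈ Finset.range k, φ (X t ω)) := by
    intro k
    induction k with
    | zero => simp
    | succ k ih =>
      simp_rw [Finset.sum_range_succ]
      exact (ih.mono (hmono k) le_rfl).add ((hX k).measurable_comp φ)
  have hbdd : ∀ k ω, |Real.exp (∑ t ∈ Finset.range k, φ (X t ω))| ≤ Real.exp (k * B) := by
    intro k ω
    rw [abs_of_pos (Real.exp_pos _)]
    refine Real.exp_le_exp.2 ?_
    calc ∑ t ∈ Finset.range k, φ (X t ω) ≤ ∑ _t ∈ Finset.range k, B :=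
          Finset.sum_le_sum fun t _ => (le_abs_self _).trans (hB _)
      _ = k * B := by simp
  intro k hk
  refine ⟨?_, ?_⟩
  · exact integrable_of_abs_le (h𝓕 k) (Real.measurable_exp.comp (hmeas k)) ⟨_, hbdd k⟩
  · induction k with
    | zero => simp
    | succ k ih =>
      refine le_trans ?_ (ih (by omega))
      simp_rw [Finset.sum_range_succ, Real.exp_add]
      exact hstep k (by omega) _ (Real.measurable_exp.comp (hmeas k)) ⟨_, hbdd k⟩
        fun ω => (Real.exp_pos _).le

theorem measureReal_le_sum_le_exp_neg [Finite α] {m0 : MeasurableSpace Ω} (μ : Measure Ω)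
    [IsProbabilityMeasure μ] {𝓕 : ℕ → MeasurableSpace Ω} (h𝓕 : ∀ t, 𝓕 t ≤ m0)
    (hmono : ∀ t, 𝓕 t ≤ 𝓕 (t + 1)) {X : ℕ → Ω → α}
    (hX : ∀ t, LevelMeasurable (𝓕 (t + 1)) (X t)) (φ : α → ℝ) (K : ℕ)
    (hstep : ∀ t < K, ∀ W : Ω → ℝ, Measurable[𝓕 t] W → (∃ C, ∀ ω, |W ω| ≤ C) →
      (∀ ω, 0 ≤ W ω) → ∫ ω, W ω * Real.exp (φ (X t ω)) ∂μ ≤ ∫ ω, W ω ∂μ)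
    (L : ℝ) {k : ℕ} (hk : k ≤ K) :
    μ.real {ω | L ≤ ∑ t ∈ Finset.range k, φ (X t ω)} ≤ Real.exp (-L) := by
  obtain ⟨hexp, hle⟩ := integral_exp_sum_le_one μ h𝓕 hmono hX φ K hstep k hk
  have h := mul_meas_ge_le_integral_of_nonneg
    (Filter.Eventually.of_forall fun ω => (Real.exp_pos _).le) hexp (Real.exp L)
  simp only [Real.exp_le_exp] at h
  rw [Real.exp_neg, ← one_div, le_div_iff₀' (Real.exp_pos L)]
  exact h.trans hle

theorem ofReal_one_sub_le_measure_forall_notMem {ι : Type*} [Fintype ι]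
    {m0 : MeasurableSpace Ω} (μ : Measure Ω) [IsProbabilityMeasure μ] (E : ι → Set Ω)
    {ε δ : ℝ} (hE : ∀ x, μ.real (E x) ≤ ε) (hδ : Fintype.card ι * ε ≤ δ) :
    ENNReal.ofReal (1 - δ) ≤ μ {ω | ∀ x, ω ∉ E x} := by
  have hU : μ.real (⋃ x, E x) ≤ δ := by
    refine (measureReal_iUnion_fintype_le E).trans (le_trans ?_ hδ)
    calc ∑ x, μ.real (E x) ≤ ∑ _x : ι, ε := Finset.sum_le_sum fun x _ => hE x
      _ = Fintype.card ι * ε := by simp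
  have hset : {ω | ∀ x, ω ∉ E x} = (⋃ x, E x)ᶜ := by
    ext ω
    simp
  have h1 : (1 : ℝ) ≤ μ.real (⋃ x, E x) + μ.real (⋃ x, E x)ᶜ := by
    have := measureReal_union_le (μ := μ) (⋃ x, E x) (⋃ x, E x)ᶜ
    rwa [Set.union_compl_self, probReal_univ] at this
  rw [hset, ← ofReal_measureReal]
  exact ENNReal.ofReal_le_ofReal (by linarith)

end ExponentialSupermartingale

section FiniteDistributions

variable {ι : Type*} [Fintype ι]

theorem IsDist.sum_mul_exp_le_one {w : ι → ℝ} (hw : IsDist w) {y : ι → ℝ} {M B d η : ℝ}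
    (hM : ∑ x, w x * y x = M) (hy : ∀ x, |y x - M| ≤ B) (hd : |d| ≤ B)
    (hη : 0 ≤ η) (hηB : 8 * B ^ 2 * η = 1) :
    ∑ x, w x * Real.exp (2 * η * d * (y x - M) - η * d ^ 2 / 2) ≤ 1 := by
  have hB : 0 ≤ B := (abs_nonneg d).trans hd
  have key : ∀ x, Real.exp (2 * η * d * (y x - M)) ≤
      1 + 2 * η * d * (y x - M) + η * d ^ 2 / 2 := by
    intro x
    have h0 : |d| * |y x - M| ≤ B * B := mul_le_mul hd (hy x) (abs_nonneg _) hB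
    have h1 : |2 * η * d * (y x - M)| ≤ 1 := by
      rw [abs_mul, abs_mul, abs_of_nonneg (by positivity : 0 ≤ 2 * η)]
      nlinarith
    have h2 := (abs_le.1 (Real.abs_exp_sub_one_sub_id_le h1)).2
    have h3 : (y x - M) ^ 2 ≤ B ^ 2 := sq_le_sq' (abs_le.1 (hy x)).1 (abs_le.1 (hy x)).2
    have h4 : (2 * η * d * (y x - M)) ^ 2 ≤ η * d ^ 2 / 2 := by
      calc (2 * η * d * (y x - M)) ^ 2 = (4 * η ^ 2 * d ^ 2) * (y x - M) ^ 2 := by ring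
        _ ≤ (4 * η ^ 2 * d ^ 2) * B ^ 2 := by gcongr
        _ = (8 * B ^ 2 * η) * (η * d ^ 2 / 2) := by ring
        _ = η * d ^ 2 / 2 := by rw [hηB, one_mul]
    linarith
  simp_rw [Real.exp_sub, mul_div_assoc']
  rw [← Finset.sum_div, div_le_one (Real.exp_pos _)]
  calc ∑ x, w x * Real.exp (2 * η * d * (y x - M))
      ≤ ∑ x, w x * (1 + 2 * η * d * (y x - M) + η * d ^ 2 / 2) :=
        Finset.sum_le_sum fun x _ => mul_le_mul_of_nonneg_left (key x) (hw.1 x)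
    _ = ∑ x, ((1 - 2 * η * d * M + η * d ^ 2 / 2) * w x + 2 * η * d * (w x * y x)) :=
        Finset.sum_congr rfl fun x _ => by ring
    _ = η * d ^ 2 / 2 + 1 := by
        rw [Finset.sum_add_distrib, ← Finset.mul_sum, ← Finset.mul_sum, hM, hw.2]
        ring
    _ ≤ Real.exp (η * d ^ 2 / 2) := Real.add_one_le_exp _

theorem IsDist.sum_mul_exp_neg_le {w : ι → ℝ} (hw : IsDist w) {z : ι → ℝ}
    (hz0 : ∀ x, 0 ≤ z x) (hz1 : ∀ x, z x ≤ 1 / 2) :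
    ∑ x, w x * Real.exp (-z x) ≤ Real.exp (-(∑ x, w x * z x) / 2) := by
  have key : ∀ x, Real.exp (-z x) ≤ 1 - z x / 2 := by
    intro x
    have h := Real.abs_exp_sub_one_sub_id_le (x := -z x)
      (by rw [abs_le]; constructor <;> linarith [hz0 x, hz1 x])
    nlinarith [(abs_le.1 h).2, hz0 x, hz1 x]
  calc ∑ x, w x * Real.exp (-z x) ≤ ∑ x, w x * (1 - z x / 2) :=
        Finset.sum_le_sum fun x _ => mul_le_mul_of_nonneg_left (key x) (hw.1 x)
    _ = ∑ x, (w x - (w x * z x) * (1 / 2)) := Finset.sum_congr rfl fun x _ => by ring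
    _ = -(∑ x, w x * z x) / 2 + 1 := by
        rw [Finset.sum_sub_distrib, ← Finset.sum_mul, hw.2]
        ring
    _ ≤ _ := Real.add_one_le_exp _

theorem IsDist.sum_mul_mem_Icc {w : ι → ℝ} (hw : IsDist w) {y : ι → ℝ} {a b : ℝ}
    (hy : ∀ x, y x ∈ Set.Icc a b) : ∑ x, w x * y x ∈ Set.Icc a b := by
  constructor
  · calc a = ∑ x, w x * a := by rw [← Finset.sum_mul, hw.2, one_mul]
      _ ≤ _ := Finset.sum_le_sum fun x _ => mul_le_mul_of_nonneg_left (hy x).1 (hw.1 x)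
  · calc ∑ x, w x * y x ≤ ∑ x, w x * b :=
          Finset.sum_le_sum fun x _ => mul_le_mul_of_nonneg_left (hy x).2 (hw.1 x)
      _ = b := by rw [← Finset.sum_mul, hw.2, one_mul]

end FiniteDistributions

section Actions

variable {m : ℕ} {A : Fin m → Type*} (i : Fin m)

theorem combine_self (b : A i) (an : ∀ j : {j : Fin m // j ≠ i}, A j.1) :
    combine i b an i = b := by
  simp [combine]

theorem restrict_combine (b : A i) (an : ∀ j : {j : Fin m // j ≠ i}, A j.1) :
    restrict i (combine i b an) = an := by
  funext j
  simp [_root_.restrict, combine, j.2]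

theorem combine_restrict (q : ∀ j, A j) : combine i (q i) (restrict i q) = q := by
  funext j
  by_cases h : j = i
  · subst h
    simp [combine]
  · simp [_root_.restrict, combine, h]

theorem sum_ite_mul_restrict [∀ j, Fintype (A j)] [∀ j, DecidableEq (A j)] (b : A i)
    (ν : (∀ j : {j : Fin m // j ≠ i}, A j.1) → ℝ) (Φ : (∀ j, A j) → ℝ) :
    ∑ q, Φ q * ((if q i = b then (1 : ℝ) else 0) * ν (restrict i q)) =
      ∑ an, ν an * Φ (combine i b an) := by
  have h1 : ∀ q, Φ q * ((if q i = b then (1 : ℝ) else 0) * ν (restrict i q)) =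
      if q i = b then ν (restrict i q) * Φ q else 0 := by
    intro q
    split_ifs <;> ring
  simp_rw [h1]
  rw [← Finset.sum_filter]
  refine Finset.sum_nbij' (restrict i) (combine i b) (by simp) (by simp [combine_self]) ?_
    (by simp [restrict_combine]) ?_
  · intro q hq
    rw [Finset.mem_filter] at hq
    rw [← hq.2, combine_restrict]
  · intro q hq
    rw [Finset.mem_filter] at hq
    rw [← hq.2, combine_restrict]

variable {S : Type*} [Fintype S] [∀ j, Fintype (A j)]

/-- The joint law of the opponents' actions and the next state when player `i` plays `b`. -/
def stepLaw (ν : (∀ j : {j : Fin m // j ≠ i}, A j.1) → ℝ) (T : (∀ j, A j) → S → ℝ) (b : A i)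
    (x : (∀ j : {j : Fin m // j ≠ i}, A j.1) × S) : ℝ :=
  ν x.1 * T (combine i b x.1) x.2

theorem sum_stepLaw_mul (ν : (∀ j : {j : Fin m // j ≠ i}, A j.1) → ℝ)
    (T : (∀ j, A j) → S → ℝ) (b : A i)
    (G : (∀ j : {j : Fin m // j ≠ i}, A j.1) → S → ℝ) :
    ∑ x, stepLaw i ν T b x * G x.1 x.2 =
      ∑ an, ν an * ∑ s', T (combine i b an) s' * G an s' := by
  rw [Fintype.sum_prod_type]
  refine Finset.sum_congr rfl fun an _ => ?_
  rw [Finset.mul_sum]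
  exact Finset.sum_congr rfl fun s' _ => mul_assoc _ _ _

theorem isDist_stepLaw {ν : (∀ j : {j : Fin m // j ≠ i}, A j.1) → ℝ}
    {T : (∀ j, A j) → S → ℝ} (hν : IsDist ν) (hT : ∀ a, IsDist (T a)) (b : A i) :
    IsDist (stepLaw i ν T b) := by
  refine ⟨fun x => mul_nonneg (hν.1 _) ((hT _).1 _), ?_⟩
  have h := sum_stepLaw_mul i ν T b (fun _ _ => 1)
  simp only [mul_one] at h
  rw [h, ← hν.2]
  exact Finset.sum_congr rfl fun an _ => by rw [(hT _).2, mul_one]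

theorem bell_eq_sum_stepLaw {P : ℕ → S → (∀ j, A j) → S → ℝ} (rew : ℕ → S → (∀ j, A j) → ℝ)
    (πneg : ℕ → S → (∀ j : {j : Fin m // j ≠ i}, A j.1) → ℝ) (polNext : S → A i) {h : ℕ}
    (f : S → A i → ℝ) {s : S} (hP : ∀ a, IsDist (P h s a)) (b : A i) :
    bell i P rew πneg polNext h f s b =
      ∑ x, stepLaw i (πneg h s) (P h s) b x *
        (rew h s (combine i b x.1) + f x.2 (polNext x.2)) := by
  rw [sum_stepLaw_mul i _ _ _ fun an s' => rew h s (combine i b an) + f s' (polNext s'), bell]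
  refine Finset.sum_congr rfl fun an _ => ?_
  rw [Finset.sum_congr rfl fun s' _ => mul_add _ _ _, Finset.sum_add_distrib, ← Finset.sum_mul,
    (hP _).2, one_mul]

theorem integral_step [∀ j, DecidableEq (A j)] {Ω Pc : Type*} [Finite Pc]
    {m1 m0 : MeasurableSpace Ω} (hm : m1 ≤ m0)
    (μ : Measure Ω) [IsFiniteMeasure μ] {Z : Ω → Pc} {X X' : Ω → S} {Q : Ω → ∀ j, A j}
    (hZ : LevelMeasurable m1 Z) (hX : LevelMeasurable m1 X) (hQ : LevelMeasurable m0 Q)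
    (hX' : LevelMeasurable m0 X') (pol : Pc → S → A i)
    (ν : S → (∀ j : {j : Fin m // j ≠ i}, A j.1) → ℝ) (T : S → (∀ j, A j) → S → ℝ)
    (hlawQ : ∀ q : ∀ j, A j,
      μ[Set.indicator {ω | Q ω = q} (fun _ => (1 : ℝ)) | m1] =ᵐ[μ]
        fun ω => (if q i = pol (Z ω) (X ω) then (1 : ℝ) else 0) * ν (X ω) (restrict i q))
    (hlawX' : ∀ s' : S,
      μ[Set.indicator {ω | X' ω = s'} (fun _ => (1 : ℝ)) |
          m1 ⊔ MeasurableSpace.comap Q ⊤] =ᵐ[μ] fun ω => T (X ω) (Q ω) s')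
    (G : Pc → S → (∀ j, A j) → S → ℝ) {W : Ω → ℝ} (hW : Measurable[m1] W)
    (hWb : ∃ C, ∀ ω, |W ω| ≤ C) :
    ∫ ω, W ω * G (Z ω) (X ω) (Q ω) (X' ω) ∂μ =
      ∫ ω, W ω * ∑ x, stepLaw i (ν (X ω)) (T (X ω)) (pol (Z ω) (X ω)) x *
        G (Z ω) (X ω) (combine i (pol (Z ω) (X ω)) x.1) x.2 ∂μ := by
  have hle : m1 ⊔ MeasurableSpace.comap Q ⊤ ≤ m0 := by
    refine sup_le hm ?_
    rintro _ ⟨B, _, rfl⟩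
    have : Q ⁻¹' B = ⋃ q ∈ B, {ω | Q ω = q} := by
      ext ω
      simp
    rw [this]
    exact MeasurableSet.biUnion (Set.to_countable _) fun q _ => hQ q
  have hQ' : LevelMeasurable (m1 ⊔ MeasurableSpace.comap Q ⊤) Q := fun q =>
    (le_sup_right : _ ≤ m1 ⊔ MeasurableSpace.comap Q ⊤) _ ⟨{q}, trivial, rfl⟩
  have hZX := hZ.prodMk hX
  have hZXQ := (hZX.mono (le_sup_left : m1 ≤ m1 ⊔ MeasurableSpace.comap Q ⊤)).prodMk hQ'
  rw [integral_eq_of_condExp_indicator hle μ hX' hlawX'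
    (F := fun s' ω => W ω * G (Z ω) (X ω) (Q ω) s')
    (fun s' => (hW.mono le_sup_left le_rfl).mul
      (hZXQ.measurable_comp fun y => G y.1.1 y.1.2 y.2 s'))
    (fun s' => exists_abs_mul_comp_le hWb (fun ω => ((Z ω, X ω), Q ω)) fun y => G y.1.1 y.1.2 y.2 s')]
  have e1 : ∀ ω, ∑ s', W ω * G (Z ω) (X ω) (Q ω) s' * T (X ω) (Q ω) s' =
      W ω * ∑ s', T (X ω) (Q ω) s' * G (Z ω) (X ω) (Q ω) s' := by
    intro ω
    rw [Finset.mul_sum]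
    exact Finset.sum_congr rfl fun s' _ => by ring
  simp_rw [e1]
  rw [integral_eq_of_condExp_indicator hm μ hQ hlawQ
    (F := fun q ω => W ω * ∑ s', T (X ω) q s' * G (Z ω) (X ω) q s')
    (fun q => hW.mul
      (hZX.measurable_comp fun y => ∑ s', T y.2 q s' * G y.1 y.2 q s'))
    (fun q => exists_abs_mul_comp_le hWb (fun ω => (Z ω, X ω)) fun y => ∑ s', T y.2 q s' * G y.1 y.2 q s')]
  refine integral_congr_ae (Filter.Eventually.of_forall fun ω => ?_)
  dsimp only
  rw [sum_ite_mul_restrict i (pol (Z ω) (X ω)) (ν (X ω))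
      fun q => W ω * ∑ s', T (X ω) q s' * G (Z ω) (X ω) q s',
    sum_stepLaw_mul i (ν (X ω)) (T (X ω)) (pol (Z ω) (X ω))
      fun an s' => G (Z ω) (X ω) (combine i (pol (Z ω) (X ω)) an) s', Finset.mul_sum]
  exact Finset.sum_congr rfl fun an _ => by ring

end Actions

section Occupancy

variable {S : Type*} [Fintype S] [DecidableEq S] {m : ℕ} {A : Fin m → Type*}
  [∀ j, Fintype (A j)] (i : Fin m) {P : ℕ → S → (∀ j, A j) → S → ℝ}
  {πneg : ℕ → S → (∀ j : {j : Fin m // j ≠ i}, A j.1) → ℝ} {Pc : Type*}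
  (pol : Pc → ℕ → S → A i) (s1 : S) (p : Pc)

theorem sum_occ_succ_mul (h : ℕ) (ψ : S → ℝ) :
    ∑ s', occ i P πneg pol s1 p (h + 1) s' * ψ s' =
      ∑ s, occ i P πneg pol s1 p h s *
        ∑ x, stepLaw i (πneg h s) (P h s) (pol p h s) x * ψ x.2 := by
  simp_rw [sum_stepLaw_mul i _ _ _ fun _ s' => ψ s', occ, Finset.sum_mul, Finset.mul_sum,
    Finset.sum_mul]
  rw [Finset.sum_comm]
  refine Finset.sum_congr rfl fun s _ => ?_
  rw [Finset.sum_comm]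
  exact Finset.sum_congr rfl fun an _ => Finset.sum_congr rfl fun s' _ => by ring

theorem isDist_occ {Hh : ℕ} (hP : ∀ h < Hh, ∀ s a, IsDist (P h s a))
    (hπ : ∀ h < Hh, ∀ s, IsDist (πneg h s)) :
    ∀ h ≤ Hh, IsDist (occ i P πneg pol s1 p h) := by
  intro h hh
  induction h with
  | zero =>
    refine ⟨fun s => ?_, ?_⟩
    · rw [occ]
      split_ifs <;> norm_num
    · simp [occ]
  | succ h ih =>
    have ih' := ih (by omega)
    have hlt : h < Hh := hh
    refine ⟨fun s' => ?_, ?_⟩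
    · rw [occ]
      exact Finset.sum_nonneg fun s _ => mul_nonneg (ih'.1 s) <| Finset.sum_nonneg fun an _ =>
        mul_nonneg ((hπ h hlt s).1 an) ((hP h hlt s _).1 s')
    · have := sum_occ_succ_mul i (P := P) (πneg := πneg) pol s1 p h (fun _ => 1)
      simp only [mul_one] at this
      rw [this, ← ih'.2]
      exact Finset.sum_congr rfl fun s _ => by
        rw [(isDist_stepLaw i (hπ h hlt s) (hP h hlt s) _).2, mul_one]

end Occupancy

section Episode

variable {S : Type*} [Fintype S] {m : ℕ} {A : Fin m → Type*}
  [∀ j, Fintype (A j)] [∀ j, DecidableEq (A j)] {Ω Pc : Type*}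

/-- One episode in which player `i` plays the policy `Z`, chosen before the episode starts,
against `πneg`: `X h` is the state and `Q h` the joint action at step `h`. -/
structure EpisodeLaw (i : Fin m) (Hh : ℕ) (P : ℕ → S → (∀ j, A j) → S → ℝ)
    (πneg : ℕ → S → (∀ j : {j : Fin m // j ≠ i}, A j.1) → ℝ) (pol : Pc → ℕ → S → A i)
    (s1 : S) {m0 : MeasurableSpace Ω} (μ : Measure Ω) (𝓗 : ℕ → MeasurableSpace Ω)
    (Z : Ω → Pc) (X : ℕ → Ω → S) (Q : ℕ → Ω → ∀ j, A j) : Prop where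
  le : ∀ h, 𝓗 h ≤ m0
  mono : Monotone 𝓗
  start : ∀ ω, X 0 ω = s1
  policy : LevelMeasurable (𝓗 0) Z
  state : ∀ h ≤ Hh, LevelMeasurable (𝓗 h) (X h)
  action : ∀ h < Hh, LevelMeasurable (𝓗 (h + 1)) (Q h)
  action_law : ∀ h < Hh, ∀ q : ∀ j, A j,
    μ[Set.indicator {ω | Q h ω = q} (fun _ => (1 : ℝ)) | 𝓗 h] =ᵐ[μ]
      fun ω => (if q i = pol (Z ω) h (X h ω) then (1 : ℝ) else 0) *
        πneg h (X h ω) (restrict i q)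
  state_law : ∀ h < Hh, ∀ s' : S,
    μ[Set.indicator {ω | X (h + 1) ω = s'} (fun _ => (1 : ℝ)) |
        𝓗 h ⊔ MeasurableSpace.comap (Q h) ⊤] =ᵐ[μ] fun ω => P h (X h ω) (Q h ω) s'

namespace EpisodeLaw

variable {i : Fin m} {Hh : ℕ} {P : ℕ → S → (∀ j, A j) → S → ℝ}
  {πneg : ℕ → S → (∀ j : {j : Fin m // j ≠ i}, A j.1) → ℝ} {pol : Pc → ℕ → S → A i}
  {s1 : S} {m0 : MeasurableSpace Ω} {μ : Measure Ω} {𝓗 : ℕ → MeasurableSpace Ω}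
  {Z : Ω → Pc} {X : ℕ → Ω → S} {Q : ℕ → Ω → ∀ j, A j}

theorem integral_step [Finite Pc] [IsFiniteMeasure μ]
    (E : EpisodeLaw i Hh P πneg pol s1 μ 𝓗 Z X Q) {h : ℕ} (hh : h < Hh)
    (G : Pc → S → (∀ j, A j) → S → ℝ) {W : Ω → ℝ} (hW : Measurable[𝓗 h] W)
    (hWb : ∃ C, ∀ ω, |W ω| ≤ C) :
    ∫ ω, W ω * G (Z ω) (X h ω) (Q h ω) (X (h + 1) ω) ∂μ =
      ∫ ω, W ω * ∑ x, stepLaw i (πneg h (X h ω)) (P h (X h ω)) (pol (Z ω) h (X h ω)) x *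
        G (Z ω) (X h ω) (combine i (pol (Z ω) h (X h ω)) x.1) x.2 ∂μ :=
  _root_.integral_step i (E.le h) μ (E.policy.mono (E.mono h.zero_le)) (E.state h hh.le)
    ((E.action h hh).mono (E.le _)) ((E.state (h + 1) hh).mono (E.le _))
    (fun p => pol p h) (πneg h) (P h) (E.action_law h hh) (E.state_law h hh) G hW hWb

theorem integral_mul_exp_sub_sq_le [Finite Pc] [IsFiniteMeasure μ]
    (E : EpisodeLaw i Hh P πneg pol s1 μ 𝓗 Z X Q)
    (hP : ∀ h < Hh, ∀ s a, IsDist (P h s a)) (hπ : ∀ h < Hh, ∀ s, IsDist (πneg h s))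
    {h : ℕ} (hh : h < Hh) {D M : S → A i → ℝ} {y : S → (∀ j, A j) → S → ℝ} {B η : ℝ}
    (hM : ∀ s b, ∑ x, stepLaw i (πneg h s) (P h s) b x * y s (combine i b x.1) x.2 = M s b)
    (hy : ∀ s q s', |y s q s' - M s (q i)| ≤ B) (hD : ∀ s b, |D s b| ≤ B)
    (hη : 0 ≤ η) (hηB : 8 * B ^ 2 * η = 1)
    {W : Ω → ℝ} (hW : Measurable[𝓗 0] W) (hWb : ∃ C, ∀ ω, |W ω| ≤ C) (hW0 : ∀ ω, 0 ≤ W ω) :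
    ∫ ω, W ω * Real.exp (2 * η * D (X h ω) (Q h ω i) *
        (y (X h ω) (Q h ω) (X (h + 1) ω) - M (X h ω) (Q h ω i)) -
          η * D (X h ω) (Q h ω i) ^ 2 / 2) ∂μ ≤ ∫ ω, W ω ∂μ := by
  have hWint := integrable_of_abs_le (E.le 0) (μ := μ) hW hWb
  rw [E.integral_step hh (fun _ s q s' => Real.exp (2 * η * D s (q i) *
      (y s q s' - M s (q i)) - η * D s (q i) ^ 2 / 2))
      (hW.mono (E.mono h.zero_le) le_rfl) hWb]
  have hdist : ∀ s b, IsDist (stepLaw i (πneg h s) (P h s) b) := fun s b =>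
    isDist_stepLaw i (hπ h hh s) (hP h hh s) b
  refine integral_mono_of_nonneg (Filter.Eventually.of_forall fun ω => ?_) hWint
    (Filter.Eventually.of_forall fun ω => ?_)
  · exact mul_nonneg (hW0 ω) <| Finset.sum_nonneg fun x _ =>
      mul_nonneg ((hdist _ _).1 x) (Real.exp_pos _).le
  · refine mul_le_of_le_one_right (hW0 ω) ?_
    simp_rw [combine_self]
    refine (hdist _ _).sum_mul_exp_le_one (hM _ _) (fun x => ?_) (hD _ _) hη hηB
    have := hy (X h ω) (combine i (pol (Z ω) h (X h ω)) x.1) x.2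
    rwa [combine_self] at this

variable [DecidableEq S]

theorem integral_state [Finite Pc] [IsFiniteMeasure μ]
    (E : EpisodeLaw i Hh P πneg pol s1 μ 𝓗 Z X Q) {h : ℕ} (hh : h ≤ Hh)
    (ψ : Pc → S → ℝ) {W : Ω → ℝ} (hW : Measurable[𝓗 0] W) (hWb : ∃ C, ∀ ω, |W ω| ≤ C) :
    ∫ ω, W ω * ψ (Z ω) (X h ω) ∂μ =
      ∫ ω, W ω * ∑ s, occ i P πneg pol s1 (Z ω) h s * ψ (Z ω) s ∂μ := by
  induction h generalizing ψ with
  | zero => simp [occ, E.start]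
  | succ h ih =>
    rw [E.integral_step hh (fun p _ _ s' => ψ p s')
      (hW.mono (E.mono h.zero_le) le_rfl) hWb,
      ih (by omega) fun p s => ∑ x, stepLaw i (πneg h s) (P h s) (pol p h s) x * ψ p x.2]
    simp_rw [sum_occ_succ_mul]

theorem integral_mul_exp_occ_sub_le [Finite Pc] [IsFiniteMeasure μ]
    (E : EpisodeLaw i Hh P πneg pol s1 μ 𝓗 Z X Q)
    (hP : ∀ h < Hh, ∀ s a, IsDist (P h s a)) (hπ : ∀ h < Hh, ∀ s, IsDist (πneg h s))
    {h : ℕ} (hh : h < Hh) {D : S → A i → ℝ} (hD0 : ∀ s b, 0 ≤ D s b)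
    (hD1 : ∀ s b, D s b ≤ 1 / 2)
    {W : Ω → ℝ} (hW : Measurable[𝓗 0] W) (hWb : ∃ C, ∀ ω, |W ω| ≤ C) (hW0 : ∀ ω, 0 ≤ W ω) :
    ∫ ω, W ω * Real.exp ((∑ s, occ i P πneg pol s1 (Z ω) h s * D s (pol (Z ω) h s)) / 2 -
        D (X h ω) (Q h ω i)) ∂μ ≤ ∫ ω, W ω ∂μ := by
  have hWint := integrable_of_abs_le (E.le 0) (μ := μ) hW hWb
  set v : Pc → ℝ := fun p =>
    Real.exp ((∑ s, occ i P πneg pol s1 p h s * D s (pol p h s)) / 2) with hv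
  have hW' : Measurable[𝓗 0] fun ω => W ω * v (Z ω) := hW.mul (E.policy.measurable_comp v)
  have hWb' := exists_abs_mul_comp_le hWb Z v
  have hocc : ∀ p, IsDist (occ i P πneg pol s1 p h) := fun p =>
    isDist_occ i pol s1 p hP hπ h hh.le
  have hdist : ∀ s b, IsDist (stepLaw i (πneg h s) (P h s) b) := fun s b =>
    isDist_stepLaw i (hπ h hh s) (hP h hh s) b
  calc _ = ∫ ω, (W ω * v (Z ω)) * Real.exp (-D (X h ω) (Q h ω i)) ∂μ := by
        simp_rw [hv, sub_eq_add_neg, Real.exp_add, mul_assoc]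
    _ = ∫ ω, (W ω * v (Z ω)) * Real.exp (-D (X h ω) (pol (Z ω) h (X h ω))) ∂μ := by
        rw [E.integral_step hh (fun _ s q _ => Real.exp (-D s (q i)))
          (hW'.mono (E.mono h.zero_le) le_rfl) hWb']
        simp_rw [combine_self, ← Finset.sum_mul, (hdist _ _).2, one_mul]
    _ = ∫ ω, (W ω * v (Z ω)) * ∑ s, occ i P πneg pol s1 (Z ω) h s *
          Real.exp (-D s (pol (Z ω) h s)) ∂μ :=
        E.integral_state hh.le (fun p s => Real.exp (-D s (pol p h s))) hW' hWb'
    _ ≤ ∫ ω, W ω ∂μ := by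
        refine integral_mono_of_nonneg (Filter.Eventually.of_forall fun ω => ?_) hWint
          (Filter.Eventually.of_forall fun ω => ?_)
        · exact mul_nonneg (mul_nonneg (hW0 ω) (Real.exp_pos _).le) <|
            Finset.sum_nonneg fun s _ => mul_nonneg ((hocc _).1 s) (Real.exp_pos _).le
        · dsimp only
          rw [mul_assoc]
          refine mul_le_of_le_one_right (hW0 ω) ?_
          calc _ ≤ v (Z ω) * Real.exp (-(∑ s, occ i P πneg pol s1 (Z ω) h s *
                  D s (pol (Z ω) h s)) / 2) :=
                mul_le_mul_of_nonneg_left ((hocc _).sum_mul_exp_neg_le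
                  (fun s => hD0 _ _) fun s => hD1 _ _) (Real.exp_pos _).le
            _ = 1 := by
                rw [hv, ← Real.exp_add, neg_div, add_neg_cancel, Real.exp_zero]

end EpisodeLaw

end Episode

section ConfidenceSets

variable {S : Type*} {m : ℕ} {A : Fin m → Type*} {i : Fin m} {Ω : Type*}
  {rew : ℕ → S → (∀ j, A j) → ℝ} {st : ℕ → ℕ → Ω → S} {aJ : ℕ → ℕ → Ω → ∀ j, A j}

theorem mem_Bset_iff [Fintype S] [∀ j, Fintype (A j)] {Hh : ℕ} {Pc Fc : Type*} [Fintype Fc]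
    [Nonempty Fc] {pol : Pc → ℕ → S → A i} {fc : Fc → ℕ → S → A i → ℝ} {β : ℝ} {ω : Ω}
    {gp : Fc × Pc} {k : ℕ} :
    gp ∈ Bset i Hh rew st aJ Pc Fc pol fc β k ω ↔
      ∀ j < k, ∀ h < Hh, ∀ g' : Fc,
        lossFn i rew st aJ (j + 1) h (fc gp.1 h)
            (fun s' => fc gp.1 (h + 1) s' (pol gp.2 (h + 1) s')) ω
          ≤ lossFn i rew st aJ (j + 1) h (fc g' h)
              (fun s' => fc gp.1 (h + 1) s' (pol gp.2 (h + 1) s')) ω + β := by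
  induction k with
  | zero => simp [Bset]
  | succ k ih =>
    have key : ∀ (a : ℝ) (l : Fc → ℝ), a ≤ (⨅ g', l g') + β ↔ ∀ g', a ≤ l g' + β := by
      intro a l
      rw [← sub_le_iff_le_add, le_ciInf_iff (Set.finite_range l).bddBelow]
      simp only [sub_le_iff_le_add]
    rw [Bset, Set.mem_inter_iff, ih, Set.mem_ofPred_eq]
    simp only [key]
    constructor
    · rintro ⟨h1, h2⟩ j hj
      rcases Nat.lt_succ_iff_lt_or_eq.1 hj with hj | rfl
      · exact h1 j hj
      · exact h2
    · exact fun h => ⟨fun j hj => h j (by omega), h k (by omega)⟩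

theorem sum_exponent_eq_lossFn_sub (k h : ℕ) (f M : S → A i → ℝ) (fn : S → ℝ) (η : ℝ) (ω : Ω) :
    ∑ t ∈ Finset.range k,
        (2 * η * (f (st t h ω) (aJ t h ω i) - M (st t h ω) (aJ t h ω i)) *
            (rew h (st t h ω) (aJ t h ω) + fn (st t (h + 1) ω) - M (st t h ω) (aJ t h ω i)) -
          η * (f (st t h ω) (aJ t h ω i) - M (st t h ω) (aJ t h ω i)) ^ 2 / 2) =
      η * (lossFn i rew st aJ k h M fn ω - lossFn i rew st aJ k h f fn ω) +
        η / 2 * ∑ t ∈ Finset.range k,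
          (f (st t h ω) (aJ t h ω i) - M (st t h ω) (aJ t h ω i)) ^ 2 := by
  rw [lossFn, lossFn, ← Finset.sum_sub_distrib, Finset.mul_sum, Finset.mul_sum,
    ← Finset.sum_add_distrib]
  exact Finset.sum_congr rfl fun t _ => by ring

end ConfidenceSets

theorem union_bound_budget {c f k n δ : ℝ} (hc : 1 ≤ c) (hf : 1 ≤ f) (hk : 1 ≤ k) (hn : 1 ≤ n)
    (hδ0 : 0 < δ) (hδ1 : δ < 1) :
    (k - 1) * (n * (f * (f * c))) * (2 * Real.exp (-(3 * Real.log (c * f * k * n / δ)))) ≤ δ := by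
  have hN : 0 < c * f * k * n / δ := by positivity
  have hexp : Real.exp (-(3 * Real.log (c * f * k * n / δ))) = (δ / (c * f * k * n)) ^ 3 := by
    rw [Real.exp_neg, mul_comm, show Real.log (c * f * k * n / δ) * 3 =
      ((3 : ℕ) : ℝ) * Real.log (c * f * k * n / δ) by push_cast; ring, Real.exp_nat_mul,
      Real.exp_log hN, ← inv_pow, inv_div]
  have hk2 : 2 * (k - 1) ≤ k ^ 2 := by nlinarith [sq_nonneg (k - 1)]
  have hM : 2 * (k - 1) * (n * (f * (f * c))) ≤ (c * f * k * n) ^ 3 := by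
    calc 2 * (k - 1) * (n * (f * (f * c))) ≤ k ^ 2 * (n * (f * (f * c))) := by gcongr
      _ = (k ^ 2 * f ^ 2 * c * n) * 1 := by ring
      _ ≤ (k ^ 2 * f ^ 2 * c * n) * (k * f * c ^ 2 * n ^ 2) := by
          refine mul_le_mul_of_nonneg_left ?_ (by positivity)
          exact one_le_mul_of_one_le_of_one_le (one_le_mul_of_one_le_of_one_le
            (one_le_mul_of_one_le_of_one_le hk hf) (one_le_pow₀ hc)) (one_le_pow₀ hn)
      _ = (c * f * k * n) ^ 3 := by ring
  have hδ3 : δ ^ 3 ≤ δ := by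
    calc δ ^ 3 ≤ δ ^ 1 := pow_le_pow_of_le_one hδ0.le hδ1.le (by norm_num)
      _ = δ := pow_one δ
  rw [hexp, div_pow]
  calc (k - 1) * (n * (f * (f * c))) * (2 * (δ ^ 3 / (c * f * k * n) ^ 3))
      = (2 * (k - 1) * (n * (f * (f * c)))) * (δ ^ 3 / (c * f * k * n) ^ 3) := by ring
    _ ≤ (c * f * k * n) ^ 3 * (δ ^ 3 / (c * f * k * n) ^ 3) := by gcongr
    _ = δ ^ 3 := by field_simp
    _ ≤ δ := hδ3

/-- properties of the square-loss confidence sets in APE.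
There are universal constants `c, C > 0` such that, under Π-completeness and the
adaptive episodic data-collection model of APE (encoded below exactly as in
Statement 14), choosing `β = c H² log(|Pc| |Fc| K H / δ)`, with probability at least
`1 - δ` the following hold simultaneously: (a) for every policy `p`, the pair
`(Q^{p × πneg}, p)` belongs to every confidence set `B^k`, `k ∈ [K]`; (b) every
`(f, p) ∈ B^k` has in-sample squared Bellman error at most `C β`; and (c) every
`(f, p) ∈ B^k` has expected squared Bellman error, on the state–action distributions
of the executed policies, at most `C β`. -/
theorem statement_15 :
    ∃ c C : ℝ, 0 < c ∧ 0 < C ∧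
    ∀ (S : Type) [Fintype S] [DecidableEq S] (m Hh K : ℕ) (A : Fin m → Type)
      [∀ j, Fintype (A j)] [∀ j, DecidableEq (A j)] (i : Fin m)
      (P : ℕ → S → (∀ j, A j) → S → ℝ), (∀ h < Hh, ∀ s a, IsDist (P h s a)) →
    ∀ rew : ℕ → S → (∀ j, A j) → ℝ, (∀ h < Hh, ∀ s a, rew h s a ∈ Set.Icc (0 : ℝ) 1) →
    ∀ πneg : ℕ → S → (∀ j : {j : Fin m // j ≠ i}, A j.1) → ℝ,
      (∀ h < Hh, ∀ s, IsDist (πneg h s)) →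
    ∀ (Pc Fc : Type) [Fintype Pc] [Fintype Fc] [Nonempty Fc]
      (pol : Pc → ℕ → S → A i) (fc : Fc → ℕ → S → A i → ℝ),
      (∀ g, ∀ h < Hh, ∀ s b, fc g h s b ∈ Set.Icc (0 : ℝ) Hh) →
      (∀ g h, Hh ≤ h → ∀ s b, fc g h s b = 0) →
      -- Π-completeness: Bellman backups of members of `Fc` stay in `Fc`
      (∀ h < Hh, ∀ (g : Fc) (p : Pc), ∃ g' : Fc, ∀ s b,
        fc g' h s b = bell i P rew πneg (pol p (h + 1)) h (fc g (h + 1)) s b) →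
    ∀ δ : ℝ, 0 < δ → δ < 1 →
    ∀ (Ω : Type) (m0 : MeasurableSpace Ω) (μ : Measure Ω), IsProbabilityMeasure μ →
    ∀ 𝒢 : ℕ → ℕ → MeasurableSpace Ω,
      (∀ t h, 𝒢 t h ≤ m0) → (∀ t h, 𝒢 t h ≤ 𝒢 t (h + 1)) →
      (∀ t, 𝒢 t Hh ≤ 𝒢 (t + 1) 0) →
    ∀ πsel : ℕ → Ω → Pc, (∀ t q, MeasurableSet[𝒢 t 0] {ω | πsel t ω = q}) →
    ∀ (st : ℕ → ℕ → Ω → S) (s1 : S), (∀ t ω, st t 0 ω = s1) →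
      (∀ t h, h ≤ Hh → ∀ s, MeasurableSet[𝒢 t h] {ω | st t h ω = s}) →
    ∀ aJ : ℕ → ℕ → Ω → ∀ j, A j,
      (∀ t h, h < Hh → ∀ q, MeasurableSet[𝒢 t (h + 1)] {ω | aJ t h ω = q}) →
      (∀ t < K, ∀ h < Hh, ∀ q : ∀ j, A j,
        μ[Set.indicator {ω | aJ t h ω = q} (fun _ => (1 : ℝ)) | 𝒢 t h] =ᵐ[μ]
          fun ω => (if q i = pol (πsel t ω) h (st t h ω) then (1 : ℝ) else 0) *
            πneg h (st t h ω) (restrict i q)) →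
      (∀ t < K, ∀ h < Hh, ∀ s' : S,
        μ[Set.indicator {ω | st t (h + 1) ω = s'} (fun _ => (1 : ℝ)) |
            (𝒢 t h) ⊔ MeasurableSpace.comap (aJ t h) ⊤] =ᵐ[μ]
          fun ω => P h (st t h ω) (aJ t h ω) s') →
    ENNReal.ofReal (1 - δ) ≤
      μ {ω |
        -- (a) the true Q-function of every policy is in every confidence set
        (∀ (p : Pc) (g : Fc),
          (∀ h < Hh, ∀ s b, fc g h s b = Qfun i Hh P rew πneg pol p h s b) →
          ∀ k < K, (g, p) ∈ Bset i Hh rew st aJ Pc Fc pol fc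
            (c * Hh ^ 2 *
              Real.log ((Fintype.card Pc : ℝ) * Fintype.card Fc * K * Hh / δ)) k ω) ∧
        -- (b) in-sample squared Bellman error of confidence-set members is `≲ β`
        (∀ k < K, ∀ gp : Fc × Pc,
          gp ∈ Bset i Hh rew st aJ Pc Fc pol fc
            (c * Hh ^ 2 *
              Real.log ((Fintype.card Pc : ℝ) * Fintype.card Fc * K * Hh / δ)) k ω →
          ∀ h < Hh,
          ∑ t ∈ Finset.range k,
              (fc gp.1 h (st t h ω) (aJ t h ω i) -
                bell i P rew πneg (pol gp.2 (h + 1)) h (fc gp.1 (h + 1))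
                  (st t h ω) (aJ t h ω i)) ^ 2
            ≤ C * (c * Hh ^ 2 *
                Real.log ((Fintype.card Pc : ℝ) * Fintype.card Fc * K * Hh / δ))) ∧
        -- (c) population squared Bellman error, on the state–action distributions of
        -- the executed policies, is `≲ β`
        (∀ k < K, ∀ gp : Fc × Pc,
          gp ∈ Bset i Hh rew st aJ Pc Fc pol fc
            (c * Hh ^ 2 *
              Real.log ((Fintype.card Pc : ℝ) * Fintype.card Fc * K * Hh / δ)) k ω →
          ∀ h < Hh,
          ∑ t ∈ Finset.range k, ∑ s,
              occ i P πneg pol s1 (πsel t ω) h s *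
                (fc gp.1 h s (pol (πsel t ω) h s) -
                  bell i P rew πneg (pol gp.2 (h + 1)) h (fc gp.1 (h + 1)) s
                    (pol (πsel t ω) h s)) ^ 2
            ≤ C * (c * Hh ^ 2 *
                Real.log ((Fintype.card Pc : ℝ) * Fintype.card Fc * K * Hh / δ)))} := by
  refine ⟨96, 9, by norm_num, by norm_num, ?_⟩
  intro S _ _ m Hh K A _ _ i P hP rew hrew πneg hπ Pc Fc _ _ _ pol fc hfc hfc0 hcomp δ hδ0 hδ1
    Ω m0 μ _ 𝒢 h𝒢 h𝒢mono h𝒢next πsel hπsel st s1 hst1 hst aJ haJ hlawA hlawS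
  have hE : ∀ t < K, EpisodeLaw i Hh P πneg pol s1 μ (𝒢 t) (πsel t) (st t) (aJ t) := fun t ht =>
    { le := h𝒢 t
      mono := monotone_nat_of_le_succ (h𝒢mono t)
      start := hst1 t
      policy := hπsel t
      state := hst t
      action := haJ t
      action_law := hlawA t ht
      state_law := hlawS t ht }
  have hmono : ∀ t, Monotone (𝒢 t) := fun t => monotone_nat_of_le_succ (h𝒢mono t)
  have hnext : ∀ t h, h ≤ Hh → 𝒢 t h ≤ 𝒢 (t + 1) 0 := fun t h hh =>
    (hmono t hh).trans (h𝒢next t)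
  set lg : ℝ := Real.log ((Fintype.card Pc : ℝ) * Fintype.card Fc * K * Hh / δ)
  set L : ℝ := 3 * lg with hL
  set M : ℕ → Fc → Pc → S → A i → ℝ := fun h g p s b =>
    bell i P rew πneg (pol p (h + 1)) h (fc g (h + 1)) s b with hMdef
  set η : ℝ := 1 / (32 * (Hh : ℝ) ^ 2) with hη
  set Y : ℕ → ℕ → Ω → ((Pc × S) × (∀ j, A j)) × S := fun h t ω =>
    (((πsel t ω, st t h ω), aJ t h ω), st t (h + 1) ω) with hY
  set φ : ℕ → Fc → Fc → Pc → ((Pc × S) × (∀ j, A j)) × S → ℝ := fun h g' g p z =>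
    2 * η * (fc g' h z.1.1.2 (z.1.2 i) - M h g p z.1.1.2 (z.1.2 i)) *
        (rew h z.1.1.2 z.1.2 + fc g (h + 1) z.2 (pol p (h + 1) z.2) -
          M h g p z.1.1.2 (z.1.2 i)) -
      η * (fc g' h z.1.1.2 (z.1.2 i) - M h g p z.1.1.2 (z.1.2 i)) ^ 2 / 2 with hφ
  set χ : ℕ → Fc → Pc → ((Pc × S) × (∀ j, A j)) × S → ℝ := fun h g p z =>
    (∑ s, occ i P πneg pol s1 z.1.1.1 h s *
        ((fc g h s (pol z.1.1.1 h s) - M h g p s (pol z.1.1.1 h s)) ^ 2 *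
          (1 / (8 * (Hh : ℝ) ^ 2)))) / 2 -
      (fc g h z.1.1.2 (z.1.2 i) - M h g p z.1.1.2 (z.1.2 i)) ^ 2 * (1 / (8 * (Hh : ℝ) ^ 2))
    with hχ
  have hYm : ∀ h < Hh, ∀ t, LevelMeasurable (𝒢 (t + 1) 0) (Y h t) := by
    intro h hh t
    refine LevelMeasurable.prodMk (LevelMeasurable.prodMk (LevelMeasurable.prodMk ?_ ?_) ?_) ?_
    · exact LevelMeasurable.mono (hπsel t) (hnext t 0 (Nat.zero_le _))
    · exact LevelMeasurable.mono (hst t h hh.le) (hnext t h hh.le)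
    · exact LevelMeasurable.mono (haJ t h hh) (hnext t (h + 1) hh)
    · exact LevelMeasurable.mono (hst t (h + 1) hh) (hnext t (h + 1) hh)
  have hMmem : ∀ h < Hh, ∀ g p s b, M h g p s b ∈ Set.Icc (0 : ℝ) Hh := by
    intro h hh g p s b
    obtain ⟨g', hg'⟩ := hcomp h hh g p
    have := hfc g' h hh s b
    rwa [hg'] at this
  have hfcmem : ∀ g h s b, fc g h s b ∈ Set.Icc (0 : ℝ) Hh := by
    intro g h s b
    by_cases hh : h < Hh
    · exact hfc g h hh s b
    · rw [hfc0 g h (not_lt.1 hh)]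
      exact ⟨le_rfl, Nat.cast_nonneg _⟩
  have hDabs : ∀ h < Hh, ∀ g' g p s b, |fc g' h s b - M h g p s b| ≤ Hh := by
    intro h hh g' g p s b
    have h1 := hfcmem g' h s b
    have h2 := hMmem h hh g p s b
    rw [abs_le]
    constructor <;> linarith [h1.1, h1.2, h2.1, h2.2]
  have hbad1 : ∀ h < Hh, ∀ g' g p, ∀ k ≤ K,
      μ.real {ω | L ≤ ∑ t ∈ Finset.range k, φ h g' g p (Y h t ω)} ≤ Real.exp (-L) := by
    intro h hh g' g p k hk
    have hH : (1 : ℝ) ≤ Hh := by exact_mod_cast (by omega : 1 ≤ Hh)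
    refine measureReal_le_sum_le_exp_neg μ (𝓕 := fun t => 𝒢 t 0) (fun t => h𝒢 t 0)
      (fun t => hnext t 0 (Nat.zero_le _)) (hYm h hh) _ K (fun t ht W hW hWb hW0 => ?_) L hk
    refine (hE t ht).integral_mul_exp_sub_sq_le hP hπ hh (B := 2 * Hh)
      (D := fun s b => fc g' h s b - M h g p s b) (M := M h g p)
      (y := fun s q s' => rew h s q + fc g (h + 1) s' (pol p (h + 1) s'))
      (fun s b => ?_) (fun s q s' => ?_) (fun s b => ?_) (by positivity) ?_ hW hWb hW0
    · exact (bell_eq_sum_stepLaw i rew πneg (pol p (h + 1)) (fc g (h + 1)) (hP h hh s) b).symm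
    · have h1 := hrew h hh s q
      have h2 := hfcmem g (h + 1) s' (pol p (h + 1) s')
      have h3 := hMmem h hh g p s (q i)
      rw [abs_le]
      constructor <;> linarith [h1.1, h1.2, h2.1, h2.2, h3.1, h3.2]
    · exact (hDabs h hh g' g p s b).trans (by linarith)
    · rw [hη]
      field_simp
      norm_num
  have hbad2 : ∀ h < Hh, ∀ g p, ∀ k ≤ K,
      μ.real {ω | L ≤ ∑ t ∈ Finset.range k, χ h g p (Y h t ω)} ≤ Real.exp (-L) := by
    intro h hh g p k hk
    have hH : (1 : ℝ) ≤ Hh := by exact_mod_cast (by omega : 1 ≤ Hh)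
    refine measureReal_le_sum_le_exp_neg μ (𝓕 := fun t => 𝒢 t 0) (fun t => h𝒢 t 0)
      (fun t => hnext t 0 (Nat.zero_le _)) (hYm h hh) _ K (fun t ht W hW hWb hW0 => ?_) L hk
    refine (hE t ht).integral_mul_exp_occ_sub_le hP hπ hh
      (D := fun s b => (fc g h s b - M h g p s b) ^ 2 * (1 / (8 * (Hh : ℝ) ^ 2)))
      (fun s b => by positivity) (fun s b => ?_) hW hWb hW0
    have h1 : (fc g h s b - M h g p s b) ^ 2 ≤ (Hh : ℝ) ^ 2 :=
      sq_le_sq' (abs_le.1 (hDabs h hh g g p s b)).1 (abs_le.1 (hDabs h hh g g p s b)).2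
    rw [mul_one_div, div_le_iff₀ (by positivity)]
    nlinarith
  set bad : Fin (K - 1) × Fin Hh × Fc × Fc × Pc → Set Ω := fun x =>
    {ω | L ≤ ∑ t ∈ Finset.range (x.1 + 1), φ x.2.1 x.2.2.1 x.2.2.2.1 x.2.2.2.2 (Y x.2.1 t ω)} ∪
    {ω | L ≤ ∑ t ∈ Finset.range (x.1 + 1), χ x.2.1 x.2.2.2.1 x.2.2.2.2 (Y x.2.1 t ω)} with hbad
  have hPc : 1 ≤ Fintype.card Pc := by
    have : Nonempty Ω := nonempty_of_isProbabilityMeasure μ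
    have : Nonempty Pc := ⟨πsel 0 (Classical.arbitrary Ω)⟩
    exact Fintype.card_pos
  have hFc : 1 ≤ Fintype.card Fc := Fintype.card_pos
  refine (ofReal_one_sub_le_measure_forall_notMem μ bad (ε := 2 * Real.exp (-L)) (δ := δ)
    (fun x => ?_) ?_).trans (measure_mono fun ω hω => ?_)
  · refine (measureReal_union_le _ _).trans ?_
    have := x.1.2
    have h1 := hbad1 x.2.1 x.2.1.2 x.2.2.1 x.2.2.2.1 x.2.2.2.2 (x.1 + 1) (by omega)
    have h2 := hbad2 x.2.1 x.2.1.2 x.2.2.2.1 x.2.2.2.2 (x.1 + 1) (by omega)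
    linarith
  · simp only [Fintype.card_prod, Fintype.card_fin]
    rcases Nat.eq_zero_or_pos K with rfl | hK
    · simpa using hδ0.le
    rcases Nat.eq_zero_or_pos Hh with hH | hH
    · simp [hH, hδ0.le]
    push_cast [Nat.cast_sub (show 1 ≤ K from hK)]
    exact union_bound_budget (by exact_mod_cast hPc) (by exact_mod_cast hFc)
      (by exact_mod_cast hK) (by exact_mod_cast hH) hδ0 hδ1
  have hgood : ∀ j, j + 1 < K → ∀ h < Hh, ∀ g' g p,
      ∑ t ∈ Finset.range (j + 1), φ h g' g p (Y h t ω) < L ∧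
        ∑ t ∈ Finset.range (j + 1), χ h g p (Y h t ω) < L := by
    intro j hj h hh g' g p
    have := hω (⟨j, by omega⟩, ⟨h, hh⟩, g', g, p)
    simp only [hbad, Set.mem_union, Set.mem_ofPred_eq, not_or, not_le] at this
    exact this
  have hloss : ∀ j, j + 1 < K → ∀ h < Hh, ∀ g' g p,
      lossFn i rew st aJ (j + 1) h (M h g p)
          (fun s' => fc g (h + 1) s' (pol p (h + 1) s')) ω -
        lossFn i rew st aJ (j + 1) h (fc g' h)
          (fun s' => fc g (h + 1) s' (pol p (h + 1) s')) ω +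
        1 / 2 * ∑ t ∈ Finset.range (j + 1), (fc g' h (st t h ω) (aJ t h ω i) -
          M h g p (st t h ω) (aJ t h ω i)) ^ 2 ≤ 96 * Hh ^ 2 * lg := by
    intro j hj h hh g' g p
    have hH : (1 : ℝ) ≤ Hh := by exact_mod_cast (by omega : 1 ≤ Hh)
    have h1 := (hgood j hj h hh g' g p).1
    have h2 := sum_exponent_eq_lossFn_sub (rew := rew) (st := st) (aJ := aJ) (j + 1) h
      (fc g' h) (M h g p) (fun s' => fc g (h + 1) s' (pol p (h + 1) s')) η ω
    have h3 := h2.symm.trans_lt h1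
    have h4 : 96 * (Hh : ℝ) ^ 2 * lg = (32 * (Hh : ℝ) ^ 2) * L := by rw [hL]; ring
    rw [h4, ← div_le_iff₀' (by positivity), div_eq_mul_one_div, ← hη]
    linarith
  have hβ : ∀ k < K, ∀ h < Hh, 0 ≤ 96 * (Hh : ℝ) ^ 2 * lg := by
    intro k hk h hh
    have : 0 ≤ lg := by
      refine Real.log_nonneg ?_
      rw [le_div_iff₀ hδ0, one_mul]
      have h1 : 1 ≤ Fintype.card Pc * Fintype.card Fc * K * Hh :=
        Nat.one_le_iff_ne_zero.2 (by
          have := hPc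
          have := hFc
          simp only [ne_eq, mul_eq_zero]
          omega)
      have h2 : (1 : ℝ) ≤ (Fintype.card Pc : ℝ) * Fintype.card Fc * K * Hh := by
        exact_mod_cast h1
      linarith
    positivity
  have hinsample : ∀ k < K, ∀ gp : Fc × Pc,
      gp ∈ Bset i Hh rew st aJ Pc Fc pol fc (96 * Hh ^ 2 * lg) k ω → ∀ h < Hh,
      ∑ t ∈ Finset.range k, (fc gp.1 h (st t h ω) (aJ t h ω i) -
        M h gp.1 gp.2 (st t h ω) (aJ t h ω i)) ^ 2 ≤ 4 * (96 * Hh ^ 2 * lg) := by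
    intro k hk gp hgp h hh
    have h0 := hβ k hk h hh
    cases k with
    | zero =>
      rw [Finset.range_zero, Finset.sum_empty]
      linarith
    | succ j =>
      obtain ⟨g', hg'⟩ := hcomp h hh gp.1 gp.2
      have h1 := mem_Bset_iff.1 hgp j (by omega) h hh g'
      have h2 : fc g' h = M h gp.1 gp.2 := funext fun s => funext fun b => hg' s b
      rw [h2] at h1
      linarith [hloss j hk h hh gp.1 gp.1 gp.2]
  refine ⟨fun p g hg k hk => mem_Bset_iff.2 fun j hj h hh g' => ?_,
    fun k hk gp hgp h hh => (hinsample k hk gp hgp h hh).trans ?_, fun k hk gp hgp h hh => ?_⟩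
  · have hnextQ : fc g (h + 1) = Qfun i Hh P rew πneg pol p (h + 1) := by
      funext s b
      by_cases hh' : h + 1 < Hh
      · exact hg (h + 1) hh' s b
      · rw [hfc0 g (h + 1) (not_lt.1 hh'), Qfun]
        simp [hh']
    have hfix : fc g h = M h g p := by
      funext s b
      rw [hg h hh s b, Qfun]
      simp only [hh, dite_true, ← hnextQ, hMdef]
    have h1 := hloss j (by omega) h hh g' g p
    rw [← hfix] at h1
    have h2 : 0 ≤ ∑ t ∈ Finset.range (j + 1), (fc g' h (st t h ω) (aJ t h ω i) -
        fc g h (st t h ω) (aJ t h ω i)) ^ 2 := Finset.sum_nonneg fun t _ => sq_nonneg _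
    linarith
  · linarith [hβ k hk h hh]
  · have h0 := hβ k hk h hh
    cases k with
    | zero =>
      rw [Finset.range_zero, Finset.sum_empty]
      linarith
    | succ j =>
      have hH : (1 : ℝ) ≤ Hh := by exact_mod_cast (by omega : 1 ≤ Hh)
      have h1 := hinsample (j + 1) hk gp hgp h hh
      have h2 := (hgood j hk h hh gp.1 gp.1 gp.2).2
      simp only [hχ, hY, ← mul_assoc, ← Finset.sum_mul, Finset.sum_sub_distrib,
        ← Finset.sum_div] at h2
      set U := ∑ t ∈ Finset.range (j + 1), ∑ s, occ i P πneg pol s1 (πsel t ω) h s *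
        (fc gp.1 h s (pol (πsel t ω) h s) - M h gp.1 gp.2 s (pol (πsel t ω) h s)) ^ 2
      set V := ∑ t ∈ Finset.range (j + 1), (fc gp.1 h (st t h ω) (aJ t h ω i) -
        M h gp.1 gp.2 (st t h ω) (aJ t h ω i)) ^ 2
      change U ≤ _
      have h3 : U * (1 / (8 * (Hh : ℝ) ^ 2)) / 2 - V * (1 / (8 * (Hh : ℝ) ^ 2)) =
          (U / 2 - V) / (8 * (Hh : ℝ) ^ 2) := by ring
      rw [h3, div_lt_iff₀ (by positivity), hL] at h2
      linarith
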